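/- Let n ≥ 2 be an integer and let s, k be real numbers with 0 ≤ s < 1/2 and k > 2s + 1. Then there exists a constant C > 0 such that for every family of nonnegative reals (v_p)_{p ∈ (ℕ*)^n}: Σ_{q ∈ (ℕ*)^n} ( Σ_{p ∈ (ℕ*)^n} p_n · (∏_{j=1}^{n−1} ⟨p_j − q_j⟩^{−k}) · (|p|^s + |q|^s)/(|p| + |q|) · v_p )² ≤ C Σ_{p ∈ (ℕ*)^n} |p|^{3+2s} v_p². -/

import Mathlib

/-- Japanese bracket `⟨y⟩ = (1 + y²)^{1/2}`. -/
noncomputable def jb (y : ℝ) : ℝ := Real.sqrt (1 + y ^ 2)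

/-- Euclidean norm of a tuple of positive integers. -/
noncomputable def en {n : ℕ} (p : Fin n → ℕ+) : ℝ := Real.sqrt (∑ j, ((p j : ℝ)) ^ 2)

open scoped ENNReal

/-- A sum over all tuples of a product of functions of one coordinate each factorizes. -/
theorem tsum_pi_prod {α : Type*} : ∀ (n : ℕ) (f : Fin n → α → ℝ≥0∞),
    ∑' q : Fin n → α, ∏ j, f j (q j) = ∏ j, ∑' y, f j y
  | 0, f => by simp
  | n + 1, f => by
    rw [← (Fin.consEquiv fun _ : Fin (n + 1) => α).tsum_eq, ENNReal.tsum_prod']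
    simp only [Fin.consEquiv_apply, Fin.prod_univ_succ, Fin.cons_zero, Fin.cons_succ,
      ENNReal.tsum_mul_left, ENNReal.tsum_mul_right]
    rw [tsum_pi_prod n fun j => f j.succ]

/-- Variant of `tsum_pi_prod` in which one coordinate is singled out. -/
theorem tsum_prod_erase_mul {α : Type*} {n : ℕ} (l : Fin n) (f : Fin n → α → ℝ≥0∞)
    (g : α → ℝ≥0∞) :
    ∑' q : Fin n → α, (∏ j ∈ Finset.univ.erase l, f j (q j)) * g (q l) =
      (∏ j ∈ Finset.univ.erase l, ∑' y, f j y) * ∑' y, g y := by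
  have h := tsum_pi_prod n (Function.update f l g)
  simp only [← Finset.prod_erase_mul _ _ (Finset.mem_univ l), Function.update_self] at h
  convert h using 2
  · ext q
    congr 1
    refine Finset.prod_congr rfl fun j hj => ?_
    rw [Function.update_of_ne (Finset.ne_of_mem_erase hj)]
  · refine Finset.prod_congr rfl fun j hj => ?_
    rw [Function.update_of_ne (Finset.ne_of_mem_erase hj)]

/-- Weighted Cauchy–Schwarz inequality for sums in `ℝ≥0∞`. -/
theorem sq_tsum_mul_mul_le {ι : Type*} (w f g : ι → ℝ≥0∞) :
    (∑' i, w i * f i * g i) ^ 2 ≤ (∑' i, w i * f i ^ 2) * ∑' i, w i * g i ^ 2 := by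
  let : MeasurableSpace ι := ⊤
  have h := ENNReal.lintegral_mul_le_Lp_mul_Lq (MeasureTheory.Measure.count : MeasureTheory.Measure ι)
    Real.HolderConjugate.two_two (f := fun i => w i ^ (1 / 2 : ℝ) * f i)
    (g := fun i => w i ^ (1 / 2 : ℝ) * g i) (measurable_from_top).aemeasurable
    (measurable_from_top).aemeasurable
  simp only [MeasureTheory.lintegral_count, Pi.mul_apply] at h
  have hw (x : ℝ≥0∞) : (x ^ (1 / 2 : ℝ)) ^ 2 = x := by
    rw [← ENNReal.rpow_two, ← ENNReal.rpow_mul]; norm_num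
  have hm (i) : w i ^ (1 / 2 : ℝ) * f i * (w i ^ (1 / 2 : ℝ) * g i) = w i * f i * g i := by
    conv_rhs => rw [← hw (w i)]
    ring
  simp only [hm, ENNReal.rpow_two, mul_pow, hw] at h
  calc _ ≤ _ := pow_le_pow_left' h 2
    _ = _ := by rw [mul_pow, hw, hw]

theorem one_le_jb (y : ℝ) : 1 ≤ jb y := by
  rw [jb, Real.one_le_sqrt]; nlinarith [sq_nonneg y]

theorem abs_le_jb (y : ℝ) : |y| ≤ jb y :=
  Real.abs_le_sqrt (by linarith)

theorem jb_sub_comm (x y : ℝ) : jb (x - y) = jb (y - x) := by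
  simp only [jb]; congr 2; ring

theorem summable_jb_rpow {k : ℝ} (hk : 1 < k) : Summable fun d : ℤ => jb d ^ (-k) := by
  refine (Real.summable_abs_int_rpow hk).of_norm_bounded_eventually ?_
  filter_upwards [(Set.finite_singleton (0 : ℤ)).compl_mem_cofinite] with d hd
  have hd' : (0 : ℝ) < |(d : ℝ)| := by simpa using hd
  rw [Real.norm_of_nonneg (Real.rpow_nonneg (zero_le_one.trans (one_le_jb _)) _)]
  exact Real.rpow_le_rpow_of_nonpos hd' (abs_le_jb _) (by linarith)

theorem tsum_jb_sub_le (k : ℝ) (x : ℕ+) :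
    ∑' y : ℕ+, ENNReal.ofReal (jb ((y : ℝ) - x) ^ (-k)) ≤
      ∑' d : ℤ, ENNReal.ofReal (jb d ^ (-k)) := by
  have hinj : Function.Injective fun y : ℕ+ => (y : ℤ) - x := fun y z h => by
    simpa using h
  simpa using ENNReal.tsum_comp_le_tsum_of_injective hinj fun d : ℤ =>
    ENNReal.ofReal (jb d ^ (-k))

theorem tsum_pnat_rpow_ne_top {r : ℝ} (hr : 1 < r) :
    ∑' a : ℕ+, ENNReal.ofReal ((a : ℝ) ^ (-r)) ≠ ∞ :=
  ((Real.summable_nat_rpow.2 (neg_lt_neg hr)).comp_injective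
    PNat.coe_injective).tsum_ofReal_ne_top

theorem coe_le_en {n : ℕ} (p : Fin n → ℕ+) (j : Fin n) : (p j : ℝ) ≤ en p :=
  Real.le_sqrt_of_sq_le <|
    Finset.single_le_sum (f := fun i => ((p i : ℝ)) ^ 2) (fun _ _ => sq_nonneg _) (Finset.mem_univ j)

theorem rpow_add_rpow_div_add_le {x y s : ℝ} (hx : 0 < x) (hy : 0 < y) (hs : 0 ≤ s) :
    (x ^ s + y ^ s) / (x + y) ≤ 2 * max x y ^ (s - 1) := by
  have hm : 0 < max x y := lt_max_of_lt_left hx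
  have h1 : x ^ s ≤ max x y ^ s := Real.rpow_le_rpow hx.le (le_max_left _ _) hs
  have h2 : y ^ s ≤ max x y ^ s := Real.rpow_le_rpow hy.le (le_max_right _ _) hs
  have h3 : max x y ≤ x + y := max_le (by linarith) (by linarith)
  rw [Real.rpow_sub_one hm.ne', mul_div_assoc']
  exact div_le_div₀ (by positivity) (by linarith) hm h3

/-- The commutator weight is dominated by a rank-one kernel in the distinguished coordinates. -/
theorem mul_rpow_add_div_le {a b x y s : ℝ} (ha : 0 < a) (hb : 0 < b) (hax : a ≤ x) (hby : b ≤ y)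
    (hs0 : 0 ≤ s) (hs : s < 1 / 2) :
    a * ((x ^ s + y ^ s) / (x + y)) ≤
      2 * a ^ (-(3 / 4 + s / 2)) * b ^ (-(3 / 4 - s / 2)) * x ^ (3 / 2 + s) := by
  have hx := ha.trans_le hax
  have hy := hb.trans_le hby
  have hm : 0 < max x y := lt_max_of_lt_left hx
  calc a * ((x ^ s + y ^ s) / (x + y)) ≤ a * (2 * max x y ^ (s - 1)) := by
        gcongr; exact rpow_add_rpow_div_add_le hx hy hs0
    _ = a * (2 * (max x y ^ (-(1 / 4 - s / 2)) * max x y ^ (-(3 / 4 - s / 2)))) := by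
        rw [← Real.rpow_add hm]; ring_nf
    _ ≤ a * (2 * (a ^ (-(1 / 4 - s / 2)) * b ^ (-(3 / 4 - s / 2)))) := by
        gcongr a * (2 * (?_ * ?_))
        · exact Real.rpow_le_rpow_of_nonpos ha (hax.trans (le_max_left _ _)) (by linarith)
        · exact Real.rpow_le_rpow_of_nonpos hb (hby.trans (le_max_right _ _)) (by linarith)
    _ = 2 * a ^ (-(3 / 4 + s / 2)) * b ^ (-(3 / 4 - s / 2)) * a ^ (3 / 2 + s) := by
        have : a * a ^ (-(1 / 4 - s / 2)) = a ^ (-(3 / 4 + s / 2)) * a ^ (3 / 2 + s) := by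
          rw [← Real.rpow_one_add' ha.le (by linarith), ← Real.rpow_add ha]; ring_nf
        linear_combination 2 * b ^ (-(3 / 4 - s / 2)) * this
    _ ≤ _ := by
        gcongr

/-- Schur-type bound for the commutator contribution `A_{F₀}`, case `0 ≤ s < 1/2`:
`Σ_q (Σ_p p_n ∏_{j<n} ⟨p_j−q_j⟩^{−k} (|p|^s+|q|^s)/(|p|+|q|) v_p)² ≤ C Σ_p |p|^{3+2s} v_p²`.
(Stated in `ℝ≥0∞` so that the inequality also asserts summability.) -/
theorem stmt18 (n : ℕ) (hn : 2 ≤ n) (s k : ℝ) (hs0 : 0 ≤ s) (hs : s < 1 / 2)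
    (hk : 2 * s + 1 < k) :
    ∃ C : ℝ, 0 < C ∧ ∀ v : (Fin n → ℕ+) → ℝ, (∀ p, 0 ≤ v p) →
      ∑' q : Fin n → ℕ+,
          (∑' p : Fin n → ℕ+,
            ENNReal.ofReal
              ((p ⟨n - 1, by omega⟩ : ℝ) *
                (∏ j ∈ Finset.univ.erase (⟨n - 1, by omega⟩ : Fin n),
                  jb ((p j : ℝ) - (q j : ℝ)) ^ (-k)) *
                ((en p ^ s + en q ^ s) / (en p + en q)) * v p)) ^ 2
        ≤ ENNReal.ofReal C *
            ∑' p : Fin n → ℕ+, ENNReal.ofReal (en p ^ (3 + 2 * s) * v p ^ 2) := by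
  have hl : n - 1 < n := by omega
  set l : Fin n := ⟨n - 1, hl⟩
  set J : Finset (Fin n) := Finset.univ.erase l with hJ
  set M : ℝ≥0∞ := ∑' d : ℤ, ENNReal.ofReal (jb d ^ (-k))
  set φ : ℕ+ → ℝ≥0∞ := fun a => ENNReal.ofReal ((a : ℝ) ^ (-(3 / 2 + s))) with hφ
  set ψ : ℕ+ → ℝ≥0∞ := fun b => ENNReal.ofReal ((b : ℝ) ^ (-(3 / 2 - s))) with hψ
  have hM_top : M ≠ ∞ := (summable_jb_rpow (by linarith)).tsum_ofReal_ne_top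
  have hφ_top : ∑' a, φ a ≠ ∞ := tsum_pnat_rpow_ne_top (by linarith)
  have hψ_top : ∑' b, ψ b ≠ ∞ := tsum_pnat_rpow_ne_top (by linarith)
  set K : ℝ≥0∞ := 4 * (M ^ J.card * ∑' a, φ a) * (M ^ J.card * ∑' b, ψ b) with hK
  have hK_top : K ≠ ∞ := by finiteness
  refine ⟨K.toReal + 1, by positivity, fun v hv => ?_⟩
  have hKC : K ≤ ENNReal.ofReal (K.toReal + 1) :=
    (ENNReal.ofReal_toReal hK_top).symm.trans_le (ENNReal.ofReal_le_ofReal (by linarith))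
  set w : (Fin n → ℕ+) → (Fin n → ℕ+) → ℝ≥0∞ := fun p q =>
    ∏ j ∈ J, ENNReal.ofReal (jb ((p j : ℝ) - q j) ^ (-k)) with hw
  have hw_comm (p q) : w p q = w q p := by
    simp only [hw]
    exact Finset.prod_congr rfl fun j _ => by rw [jb_sub_comm]
  have hsum (q : Fin n → ℕ+) (g : ℕ+ → ℝ≥0∞) :
      ∑' p, w p q * g (p l) ≤ M ^ J.card * ∑' a, g a := by
    simp only [hw, hJ]
    rw [tsum_prod_erase_mul l (fun j (y : ℕ+) => ENNReal.ofReal (jb ((y : ℝ) - q j) ^ (-k)))]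
    gcongr
    exact Finset.prod_le_pow_card _ _ _ fun j _ => tsum_jb_sub_le k (q j)
  set F : (Fin n → ℕ+) → (Fin n → ℕ+) → ℝ≥0∞ := fun p q =>
    ENNReal.ofReal (2 * (p l : ℝ) ^ (-(3 / 4 + s / 2)) * (q l : ℝ) ^ (-(3 / 4 - s / 2))) with hF
  set G : (Fin n → ℕ+) → ℝ≥0∞ := fun p => ENNReal.ofReal (en p ^ (3 / 2 + s) * v p) with hG
  have hpos (p : Fin n → ℕ+) : (0 : ℝ) < p l := by exact_mod_cast (p l).pos
  have hen (p : Fin n → ℕ+) : 0 < en p := (hpos p).trans_le (coe_le_en p l)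
  have hFsq (p q) : F p q ^ 2 = 4 * ψ (q l) * φ (p l) := by
    have h4 : (4 : ℝ≥0∞) = ENNReal.ofReal 4 := by simp
    have hp := hpos p
    have hq := hpos q
    simp only [hF, hφ, hψ]
    rw [← ENNReal.ofReal_pow (by positivity), h4, ← ENNReal.ofReal_mul (by positivity),
      ← ENNReal.ofReal_mul (by positivity), mul_pow, mul_pow, ← Real.rpow_mul_natCast hp.le,
      ← Real.rpow_mul_natCast hq.le]
    ring_nf
  have hGsq (p) : G p ^ 2 = ENNReal.ofReal (en p ^ (3 + 2 * s) * v p ^ 2) := by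
    have hp := hen p
    have hvp := hv p
    simp only [hG]
    rw [← ENNReal.ofReal_pow (by positivity), mul_pow, ← Real.rpow_mul_natCast hp.le]
    ring_nf
  have hterm (p q : Fin n → ℕ+) :
      ENNReal.ofReal ((p l : ℝ) * (∏ j ∈ J, jb ((p j : ℝ) - (q j : ℝ)) ^ (-k)) *
        ((en p ^ s + en q ^ s) / (en p + en q)) * v p) ≤ w p q * F p q * G p := by
    have hjb (j : Fin n) : 0 ≤ jb ((p j : ℝ) - (q j : ℝ)) ^ (-k) :=
      Real.rpow_nonneg (zero_le_one.trans (one_le_jb _)) _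
    have hprod := Finset.prod_nonneg fun j (_ : j ∈ J) => hjb j
    have hp := hpos p
    have hq := hpos q
    simp only [hw, hF, hG]
    rw [← ENNReal.ofReal_prod_of_nonneg fun j _ => hjb j, ← ENNReal.ofReal_mul hprod,
      ← ENNReal.ofReal_mul (by positivity)]
    refine ENNReal.ofReal_le_ofReal ?_
    have h := mul_le_mul_of_nonneg_left (mul_rpow_add_div_le hp hq (coe_le_en p l) (coe_le_en q l)
      hs0 hs) (mul_nonneg hprod (hv p))
    linarith
  simp only [← hGsq]
  calc _ ≤ ∑' q, (∑' p, w p q * F p q * G p) ^ 2 := by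
        gcongr with q p
        exact hterm p q
    _ ≤ ∑' q, (∑' p, w p q * F p q ^ 2) * ∑' p, w p q * G p ^ 2 := by
        gcongr with q
        exact sq_tsum_mul_mul_le _ _ _
    _ ≤ ∑' q, 4 * ψ (q l) * (M ^ J.card * ∑' a, φ a) * ∑' p, w p q * G p ^ 2 := by
        gcongr with q
        simp only [hFsq, mul_left_comm (w _ _), ENNReal.tsum_mul_left]
        gcongr
        exact hsum q φ
    _ = 4 * (M ^ J.card * ∑' a, φ a) * ∑' p, G p ^ 2 * ∑' q, w q p * ψ (q l) := by
        set A := M ^ J.card * ∑' a, φ a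
        simp only [← ENNReal.tsum_mul_left]
        rw [ENNReal.tsum_comm]
        refine tsum_congr fun p => tsum_congr fun q => ?_
        rw [hw_comm]; ring
    _ ≤ 4 * (M ^ J.card * ∑' a, φ a) * ∑' p, G p ^ 2 * (M ^ J.card * ∑' b, ψ b) := by
        gcongr with p
        exact hsum p ψ
    _ = K * ∑' p, G p ^ 2 := by
        rw [ENNReal.tsum_mul_right, hK]; ring
    _ ≤ _ := by gcongr
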